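/- Let κ_v, a_v, σ_v > 0 and θ_v ≥ 0, let n ∈ ℕ, and let ψ_n : ℝ → ℝ be a smooth compactly supported function with 0 ≤ ψ_n ≤ 1, ψ_n(x) = 1 for x ∈ (−n, n), and support of ψ_n contained in (−n−1, n+1). Define g_n(s,u,x) = ψ_n(x)·(θ_v·s·1_{(0,∞)}(s) + σ_v·u·√x·1_{(0,∞)}(x)). Then for every R > 0 there exists a constant C_R > 0 such that for all x, y ∈ ℝ with |x| ≤ R and |y| ≤ R one has ∫_{ℝ²} (g_n(s,u,x) − g_n(s,u,y))² dν₁(s,u) ≤ C_R·|x − y|. -/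

import Mathlib

open MeasureTheory Real Set

/-- The Gamma Lévy density `g_γ(s) = (α/s)·e^{−βs}` for `s > 0`, `0` otherwise. -/
noncomputable def gGamma (α β : ℝ) (s : ℝ) : ℝ :=
  if 0 < s then (α / s) * Real.exp (-β * s) else 0

/-- The one-dimensional heat kernel `p₁(s,u) = (2πs)^{−1/2}·e^{−u²/(2s)}` for `s > 0`. -/
noncomputable def p1 (s u : ℝ) : ℝ :=
  if 0 < s then (Real.sqrt (2 * Real.pi * s))⁻¹ * Real.exp (-(u ^ 2) / (2 * s)) else 0

/-- The measure `ν₁` on `ℝ²` with density `(s,u) ↦ g_γ(s)·p₁(s,u)` w.r.t. Lebesgue measure. -/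
noncomputable def nu1 (α β : ℝ) : Measure (ℝ × ℝ) :=
  (volume : Measure (ℝ × ℝ)).withDensity fun q => ENNReal.ofReal (gGamma α β q.1 * p1 q.1 q.2)

/-- The indicator function `1_{(0,∞)}`. -/
noncomputable def indPos (x : ℝ) : ℝ := if 0 < x then 1 else 0

/-- The jump coefficient of the variance equation:
`g_V(s,u,x) = θ_v·s·1_{(0,∞)}(s) + σ_v·u·√x·1_{(0,∞)}(x)`. -/
noncomputable def gV (θv σv : ℝ) (s u x : ℝ) : ℝ :=
  θv * s * indPos s + σv * u * Real.sqrt x * indPos x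

theorem measurable_gGamma (α β : ℝ) : Measurable (gGamma α β) := by
  unfold gGamma
  exact Measurable.ite measurableSet_Ioi (by fun_prop) measurable_const

theorem measurable_p1 : Measurable fun q : ℝ × ℝ => p1 q.1 q.2 := by
  unfold p1
  exact Measurable.ite (measurableSet_lt measurable_const measurable_fst) (by fun_prop)
    measurable_const

theorem ofReal_p1_eq_gaussianPDF {s : ℝ} (hs : 0 < s) (u : ℝ) :
    ENNReal.ofReal (p1 s u) = ProbabilityTheory.gaussianPDF 0 s.toNNReal u := by
  simp [p1, hs, ProbabilityTheory.gaussianPDF, ProbabilityTheory.gaussianPDFReal, hs.le]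

theorem lintegral_p1_mul {s : ℝ} (hs : 0 < s) (f : ℝ → ENNReal) (hf : Measurable f) :
    ∫⁻ u, ENNReal.ofReal (p1 s u) * f u =
      ∫⁻ u, f u ∂ProbabilityTheory.gaussianReal 0 s.toNNReal := by
  have hs' : s.toNNReal ≠ 0 := by simpa using hs
  rw [ProbabilityTheory.gaussianReal_of_var_ne_zero _ hs',
    lintegral_withDensity_eq_lintegral_mul _ (ProbabilityTheory.measurable_gaussianPDF _ _) hf]
  simp only [Pi.mul_apply, ofReal_p1_eq_gaussianPDF hs]

theorem lintegral_sq_gaussianReal {s : ℝ} (hs : 0 < s) :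
    ∫⁻ u, ENNReal.ofReal (u ^ 2) ∂ProbabilityTheory.gaussianReal 0 s.toNNReal =
      ENNReal.ofReal s := by
  have h := ProbabilityTheory.evariance_eq_lintegral_ofReal (id : ℝ → ℝ)
    (ProbabilityTheory.gaussianReal 0 s.toNNReal)
  rw [← (ProbabilityTheory.memLp_id_gaussianReal 2).ofReal_variance_eq,
    ProbabilityTheory.variance_id_gaussianReal] at h
  simpa [hs.le] using h.symm

theorem lintegral_gGamma_mul_p1_mul (α β : ℝ) (hα : 0 < α) {s : ℝ} (hs : 0 < s) :
    ∫⁻ u, ENNReal.ofReal (gGamma α β s * p1 s u) * ENNReal.ofReal (s ^ 2 + u ^ 2) =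
      ENNReal.ofReal (α * (Real.exp (-β * s) * (s + 1))) := by
  have hg : 0 ≤ gGamma α β s := by rw [gGamma, if_pos hs]; positivity
  simp_rw [ENNReal.ofReal_mul hg, mul_assoc]
  rw [lintegral_const_mul' _ _ ENNReal.ofReal_ne_top,
    lintegral_p1_mul hs _ (by fun_prop)]
  simp_rw [fun u : ℝ => ENNReal.ofReal_add (sq_nonneg s) (sq_nonneg u)]
  rw [lintegral_add_left measurable_const, lintegral_sq_gaussianReal hs, lintegral_const,
    measure_univ, mul_one, ← ENNReal.ofReal_add (sq_nonneg s) hs.le, ← ENNReal.ofReal_mul hg,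
    gGamma, if_pos hs]
  congr 1
  field_simp

theorem integrableOn_exp_neg_mul_mul_add_one {β : ℝ} (hβ : 0 < β) :
    IntegrableOn (fun s : ℝ => Real.exp (-β * s) * (s + 1)) (Ioi 0) := by
  have h0 := integrableOn_rpow_mul_exp_neg_mul_rpow (s := 0) (p := 1) (b := β)
    (by norm_num) one_pos hβ
  have h1 := integrableOn_rpow_mul_exp_neg_mul_rpow (s := 1) (p := 1) (b := β)
    (by norm_num) one_pos hβ
  refine (h1.add h0).congr_fun (fun s _ => ?_) measurableSet_Ioi
  simp only [Pi.add_apply, Real.rpow_one, Real.rpow_zero]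
  ring

theorem lintegral_sq_add_sq_nu1_lt_top {α β : ℝ} (hα : 0 < α) (hβ : 0 < β) :
    ∫⁻ q : ℝ × ℝ, ENNReal.ofReal (q.1 ^ 2 + q.2 ^ 2) ∂nu1 α β < ⊤ := by
  have hd : Measurable fun q : ℝ × ℝ => ENNReal.ofReal (gGamma α β q.1 * p1 q.1 q.2) :=
    (((measurable_gGamma α β).comp measurable_fst).mul measurable_p1).ennreal_ofReal
  have hf : Measurable fun q : ℝ × ℝ => ENNReal.ofReal (q.1 ^ 2 + q.2 ^ 2) := by fun_prop
  rw [nu1, lintegral_withDensity_eq_lintegral_mul _ hd hf, Measure.volume_eq_prod,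
    lintegral_prod _ (hd.mul hf).aemeasurable]
  have hs : ∀ s : ℝ,
      ∫⁻ u, ENNReal.ofReal (gGamma α β s * p1 s u) * ENNReal.ofReal (s ^ 2 + u ^ 2) =
        (Ioi (0 : ℝ)).indicator
          (fun s => ENNReal.ofReal (α * (Real.exp (-β * s) * (s + 1)))) s := by
    intro s
    by_cases hs : 0 < s
    · rw [indicator_of_mem (mem_Ioi.2 hs), lintegral_gGamma_mul_p1_mul α β hα hs]
    · rw [indicator_of_notMem (by simpa using hs)]
      simp [gGamma, hs]
  simp only [Pi.mul_apply, hs]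
  rw [lintegral_indicator measurableSet_Ioi]
  exact ((integrableOn_exp_neg_mul_mul_add_one hβ).const_mul α).lintegral_lt_top

theorem sq_sqrt_sub_sqrt_le (x y : ℝ) : (√x - √y) ^ 2 ≤ |x - y| := by
  wlog h : y ≤ x generalizing x y
  · rw [abs_sub_comm, ← neg_sub, neg_sq]
    exact this y x (le_of_not_ge h)
  have hxy : √y ≤ √x := Real.sqrt_le_sqrt h
  rw [abs_of_nonneg (sub_nonneg.2 h)]
  rcases le_total y 0 with hy | hy
  · rw [Real.sqrt_eq_zero_of_nonpos hy, sub_zero]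
    rcases le_total x 0 with hx | hx
    · rw [Real.sqrt_eq_zero_of_nonpos hx]; linarith
    · rw [Real.sq_sqrt hx]; linarith
  · nlinarith [Real.sq_sqrt hy, Real.sq_sqrt (hy.trans h), Real.sqrt_nonneg y]

theorem gV_eq (θv σv s u x : ℝ) : gV θv σv s u x = θv * (s * indPos s) + σv * u * √x := by
  unfold gV
  rcases le_or_gt x 0 with hx | hx
  · simp [Real.sqrt_eq_zero_of_nonpos hx, mul_assoc]
  · simp [indPos, hx, mul_assoc]

theorem sq_mul_indPos_le (s : ℝ) : (s * indPos s) ^ 2 ≤ s ^ 2 := by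
  unfold indPos
  split_ifs <;> simp [sq_nonneg]

/-- The squared increment of the localized coefficient is controlled by `|x - y|` times the
quadratic weight `s² + u²`. -/
theorem sq_mul_gV_sub_le {ψ : ℝ → ℝ} {L R : ℝ} (hL : ∀ x y, |ψ x - ψ y| ≤ L * |x - y|)
    (hψ : ∀ x, ψ x ∈ Icc (0 : ℝ) 1) (θv σv s u : ℝ) {x y : ℝ} (hx : |x| ≤ R) (hy : |y| ≤ R) :
    (ψ x * gV θv σv s u x - ψ y * gV θv σv s u y) ^ 2 ≤
      (4 * θv ^ 2 * L ^ 2 * R + 4 * σv ^ 2 * (2 * L ^ 2 * R ^ 2 + 1)) * |x - y| *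
        (s ^ 2 + u ^ 2) := by
  have hR : 0 ≤ R := (abs_nonneg x).trans hx
  set d := |x - y| with hd
  have hd0 : 0 ≤ d := abs_nonneg _
  have hdR : d ≤ 2 * R := (abs_sub x y).trans (by linarith)
  set a := ψ x - ψ y with ha
  have haL : a ^ 2 ≤ 2 * L ^ 2 * R * d := by
    have h1 : a ^ 2 ≤ (L * d) ^ 2 := by
      rw [← sq_abs a]
      exact pow_le_pow_left₀ (abs_nonneg _) (hL x y) 2
    have h2 : d * d ≤ 2 * R * d := mul_le_mul_of_nonneg_right hdR hd0
    nlinarith [mul_le_mul_of_nonneg_left h2 (sq_nonneg L)]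
  set b := ψ x * √x - ψ y * √y with hb
  have hbd : b ^ 2 ≤ 2 * (2 * L ^ 2 * R ^ 2 + 1) * d := by
    have hxR : √x ^ 2 ≤ R := by
      rcases le_total x 0 with h | h
      · simpa [Real.sqrt_eq_zero_of_nonpos h] using hR
      · rw [Real.sq_sqrt h]; exact (le_abs_self x).trans hx
    have h1 : (a * √x) ^ 2 ≤ 2 * L ^ 2 * R ^ 2 * d := by
      rw [mul_pow]
      calc a ^ 2 * √x ^ 2 ≤ (2 * L ^ 2 * R * d) * R := by gcongr
        _ = _ := by ring
    have h2 : (ψ y * (√x - √y)) ^ 2 ≤ d := by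
      rw [mul_pow]
      have h3 : ψ y ^ 2 ≤ 1 := pow_le_one₀ (hψ y).1 (hψ y).2
      calc ψ y ^ 2 * (√x - √y) ^ 2 ≤ 1 * d := by
            gcongr
            exact sq_sqrt_sub_sqrt_le x y
        _ = d := one_mul d
    have h4 : b = a * √x + ψ y * (√x - √y) := by rw [hb, ha]; ring
    rw [h4]
    linarith [add_sq_le (a := a * √x) (b := ψ y * (√x - √y))]
  have hdecomp : ψ x * gV θv σv s u x - ψ y * gV θv σv s u y =
      θv * a * (s * indPos s) + σv * b * u := by
    rw [gV_eq, gV_eq, ha, hb]; ring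
  have h1 : (θv * a * (s * indPos s)) ^ 2 ≤ θv ^ 2 * (2 * L ^ 2 * R * d) * (s ^ 2 + u ^ 2) := by
    rw [mul_pow, mul_pow]
    gcongr
    linarith [sq_mul_indPos_le s, sq_nonneg u]
  have h2 : (σv * b * u) ^ 2 ≤
      σv ^ 2 * (2 * (2 * L ^ 2 * R ^ 2 + 1) * d) * (s ^ 2 + u ^ 2) := by
    rw [mul_pow, mul_pow]
    gcongr
    linarith [sq_nonneg s]
  rw [hdecomp]
  linarith [add_sq_le (a := θv * a * (s * indPos s)) (b := σv * b * u)]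

/-- The localized square-root Hölder-type estimate: for the cutoff coefficient
`g_n(s,u,x) = ψ_n(x)·g_V(s,u,x)`, where `ψ_n` is smooth, compactly supported, `0 ≤ ψ_n ≤ 1`,
`ψ_n = 1` on `(−n,n)` and `supp ψ_n ⊆ (−n−1, n+1)`, for every `R > 0` there is `C_R > 0` with
`∫_{ℝ²} (g_n(s,u,x) − g_n(s,u,y))² dν₁(s,u) ≤ C_R·|x − y|` whenever `|x|, |y| ≤ R`. -/
theorem gn_sq_difference_integral_holder_localized (α β κv av σv θv : ℝ)
    (hα : 0 < α) (hβ : 0 < β) (hκv : 0 < κv) (hav : 0 < av) (hσv : 0 < σv) (hθv : 0 ≤ θv)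
    (n : ℕ) (ψ : ℝ → ℝ)
    (hψ_smooth : ContDiff ℝ (⊤ : ℕ∞) ψ) (hψ_cpt : HasCompactSupport ψ)
    (hψ_mem : ∀ x, ψ x ∈ Set.Icc (0 : ℝ) 1)
    (hψ_one : ∀ x ∈ Set.Ioo (-(n : ℝ)) (n : ℝ), ψ x = 1)
    (hψ_supp : Function.support ψ ⊆ Set.Ioo (-(n : ℝ) - 1) ((n : ℝ) + 1)) :
    ∀ R > 0, ∃ C > 0, ∀ x y : ℝ, |x| ≤ R → |y| ≤ R →
      (∫⁻ q : ℝ × ℝ,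
          ENNReal.ofReal ((ψ x * gV θv σv q.1 q.2 x - ψ y * gV θv σv q.1 q.2 y) ^ 2)
            ∂nu1 α β) ≤
        ENNReal.ofReal (C * |x - y|) := by
  intro R hR
  obtain ⟨L, hL⟩ := ContDiff.lipschitzWith_of_hasCompactSupport hψ_cpt hψ_smooth (by simp)
  have hL' : ∀ x y, |ψ x - ψ y| ≤ L * |x - y| := fun x y => by
    simpa [Real.dist_eq] using hL.dist_le_mul x y
  set K : ℝ := 4 * θv ^ 2 * (L : ℝ) ^ 2 * R + 4 * σv ^ 2 * (2 * (L : ℝ) ^ 2 * R ^ 2 + 1) with hK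
  have hK0 : 0 < K := by positivity
  set M := ∫⁻ q : ℝ × ℝ, ENNReal.ofReal (q.1 ^ 2 + q.2 ^ 2) ∂nu1 α β with hM
  have hMtop : M ≠ ⊤ := (lintegral_sq_add_sq_nu1_lt_top hα hβ).ne
  have hM0 : 0 ≤ M.toReal := ENNReal.toReal_nonneg
  refine ⟨K * (M.toReal + 1), by positivity, fun x y hx hy => ?_⟩
  have hKd : 0 ≤ K * |x - y| := by positivity
  calc
    _ ≤ ∫⁻ q : ℝ × ℝ, ENNReal.ofReal (K * |x - y|) * ENNReal.ofReal (q.1 ^ 2 + q.2 ^ 2)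
          ∂nu1 α β := by
      refine lintegral_mono fun q => ?_
      rw [← ENNReal.ofReal_mul hKd]
      exact ENNReal.ofReal_le_ofReal (sq_mul_gV_sub_le hL' hψ_mem θv σv q.1 q.2 hx hy)
    _ = ENNReal.ofReal (K * |x - y|) * ENNReal.ofReal M.toReal := by
      rw [lintegral_const_mul' _ _ ENNReal.ofReal_ne_top, ENNReal.ofReal_toReal hMtop]
    _ = ENNReal.ofReal (K * |x - y| * M.toReal) := (ENNReal.ofReal_mul hKd).symm
    _ ≤ _ := ENNReal.ofReal_le_ofReal (by linarith)
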